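/- Fix integers k ≥ 1 and m ≥ 1 with m odd, and let A = A(k,m) be the plumbing matrix of the graph Γ(k,m) described in the context, of size N = 2 + 2^k·(2^k·m + 7). Let w ∈ ℤ^N be the vector whose coordinate is 1 at the central vertex c and at each vertex v_{i,j} with j even and 2 ≤ j ≤ 2^k·m − 2, and 0 at all other vertices. Let σ(A) denote the signature of A (the number of positive eigenvalues minus the number of negative eigenvalues of the real symmetric matrix A). Then (σ(A) − wᵀAw)/8 = −2^k − 1/4, as rational numbers. -/

import Mathlib

open scoped Matrix

/-- Vertices of the plumbing graph `Γ(k,m)`: `none` is the central vertex `c`,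
`some none` is the vertex `u`, and `some (some (i, j))` is the vertex `v_{i, j+1}`
on the `i`-th leg (so `j.val + 1` is the label `1, …, 2^k·m + 7`). -/
abbrev PlumbVtx (k m : ℕ) := Option (Option (Fin (2 ^ k) × Fin (2 ^ k * m + 7)))

/-- Adjacency in `Γ(k,m)`: `c` is adjacent to `u` and to each `v_{i,1}`, and
consecutive vertices `v_{i,j}`, `v_{i,j+1}` of each leg are adjacent. -/
def plumbAdj (k m : ℕ) : PlumbVtx k m → PlumbVtx k m → Bool
  | none, some none => true
  | some none, none => true
  | none, some (some (_, j)) => j.val == 0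
  | some (some (_, j)), none => j.val == 0
  | some (some (i, j)), some (some (i', j')) =>
      i == i' && (j.val + 1 == j'.val || j'.val + 1 == j.val)
  | _, _ => false

/-- Weights of `Γ(k,m)`: `wt c = −2^k`, `wt u = −m`, `wt v_{i,j} = −3` if
`j = 2^k·m − 1` and `−2` otherwise. -/
def plumbWt (k m : ℕ) : PlumbVtx k m → ℤ
  | none => -(2 ^ k : ℤ)
  | some none => -(m : ℤ)
  | some (some (_, j)) => if j.val + 2 = 2 ^ k * m then -3 else -2

/-- The plumbing matrix `A(k,m)`: diagonal entries are the weights, off-diagonal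
entries are `1` for adjacent vertices and `0` otherwise. -/
def plumbMat (k m : ℕ) : Matrix (PlumbVtx k m) (PlumbVtx k m) ℤ :=
  Matrix.of fun x y => if x = y then plumbWt k m x else if plumbAdj k m x y then 1 else 0

/-- The spherical Wu class `w`: coordinate `1` at the central vertex `c` and at
each vertex `v_{i,j}` with `j` even and `2 ≤ j ≤ 2^k·m − 2`, and `0` elsewhere. -/
def plumbW (k m : ℕ) : PlumbVtx k m → ℤ
  | none => 1
  | some none => 0
  | some (some (_, j)) =>
      if (j.val + 1) % 2 = 0 ∧ 2 ≤ j.val + 1 ∧ j.val + 1 ≤ 2 ^ k * m - 2 then 1 else 0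

/-- The signature of a real symmetric matrix: the number of positive eigenvalues
minus the number of negative eigenvalues. -/
noncomputable def matSig {n : Type*} [Fintype n] [DecidableEq n]
    (A : Matrix n n ℝ) (hA : A.IsHermitian) : ℤ :=
  (Nat.card {i // 0 < hA.eigenvalues i} : ℤ) - (Nat.card {i // hA.eigenvalues i < 0} : ℤ)

/-- A real symmetric matrix with non-negative off-diagonal entries, sending some positive vector
to a negative one, has only negative eigenvalues. -/
theorem eigenvalues_neg_of_mulVec_neg {n : Type*} [Fintype n] [DecidableEq n]
    {A : Matrix n n ℝ} (hA : A.IsHermitian) (hoff : ∀ x y, x ≠ y → 0 ≤ A x y)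
    (d : n → ℝ) (hd : ∀ x, 0 < d x) (hAd : ∀ x, (A *ᵥ d) x < 0) (i : n) :
    hA.eigenvalues i < 0 := by
  set μ := hA.eigenvalues i
  set v : n → ℝ := (hA.eigenvectorBasis i).ofLp
  have hv : A *ᵥ v = μ • v := hA.mulVec_eigenvectorBasis i
  have hv0 : v ≠ 0 := fun h =>
    hA.eigenvectorBasis.orthonormal.ne_zero i ((WithLp.ofLp_eq_zero 2).1 h)
  obtain ⟨z, hz⟩ := Function.ne_iff.1 hv0
  obtain ⟨x, -, hx⟩ := Finset.exists_max_image Finset.univ (fun y => |v y| / d y)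
    ⟨i, Finset.mem_univ i⟩
  set t := |v x| / d x
  have ht : 0 < t := (div_pos (abs_pos.2 hz) (hd z)).trans_le (hx z (Finset.mem_univ z))
  have hvx : |v x| = t * d x := (div_mul_cancel₀ _ (hd x).ne').symm
  have hvy (y : n) : |v y| ≤ t * d y := (div_le_iff₀ (hd y)).1 (hx y (Finset.mem_univ y))
  have hrow : (μ - A x x) * v x = ∑ y ∈ Finset.univ.erase x, A x y * v y := by
    have h := congrFun hv x
    simp only [Matrix.mulVec, dotProduct, Pi.smul_apply, smul_eq_mul] at h
    rw [← Finset.add_sum_erase _ _ (Finset.mem_univ x)] at h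
    linarith
  have hdiag : A x x * d x + ∑ y ∈ Finset.univ.erase x, A x y * d y < 0 := by
    have h := hAd x
    simp only [Matrix.mulVec, dotProduct] at h
    rwa [← Finset.add_sum_erase _ _ (Finset.mem_univ x)] at h
  have hbound : (μ - A x x) * |v x| ≤ t * ∑ y ∈ Finset.univ.erase x, A x y * d y :=
    calc (μ - A x x) * |v x| ≤ |(μ - A x x) * v x| := by
          rw [abs_mul]
          exact mul_le_mul_of_nonneg_right (le_abs_self _) (abs_nonneg _)
      _ ≤ ∑ y ∈ Finset.univ.erase x, |A x y * v y| := by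
          rw [hrow]
          exact Finset.abs_sum_le_sum_abs _ _
      _ ≤ ∑ y ∈ Finset.univ.erase x, t * (A x y * d y) := by
          refine Finset.sum_le_sum fun y hy => ?_
          have h0 := hoff x y (Finset.ne_of_mem_erase hy).symm
          rw [abs_mul, abs_of_nonneg h0, mul_left_comm]
          exact mul_le_mul_of_nonneg_left (hvy y) h0
      _ = _ := (Finset.mul_sum _ _ _).symm
  rw [hvx] at hbound
  have h := mul_neg_of_pos_of_neg ht hdiag
  have hμ : μ * (t * d x) < 0 := by linarith
  exact neg_of_mul_neg_left hμ (mul_pos ht (hd x)).le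

theorem matSig_eq_neg_card {n : Type*} [Fintype n] [DecidableEq n]
    {A : Matrix n n ℝ} (hA : A.IsHermitian) (h : ∀ i, hA.eigenvalues i < 0) :
    matSig A hA = -(Fintype.card n : ℤ) := by
  have hpos : IsEmpty {i // 0 < hA.eigenvalues i} := ⟨fun i => (h i).not_gt i.2⟩
  have hneg : Nat.card {i // hA.eigenvalues i < 0} = Fintype.card n := by
    rw [Nat.card_congr (Equiv.subtypeUnivEquiv h), Nat.card_eq_fintype_card]
  rw [matSig, hneg, Nat.card_of_isEmpty]
  simp

/-- The vector on `Γ(k,m)` with value `e` at `u` and with the values `F 0, F 1, F 2, …` along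
each path `c, v_{i,1}, v_{i,2}, …`. -/
def legVec (k m : ℕ) (F : ℕ → ℤ) (e : ℤ) : PlumbVtx k m → ℤ
  | none => F 0
  | some none => e
  | some (some (_, j)) => F (j.val + 1)

theorem Fin.sum_ite_val_eq {n : ℕ} (F : ℕ → ℤ) (a : ℕ) :
    ∑ j : Fin n, (if a = j.val then F j.val else 0) = if a < n then F a else 0 := by
  rw [Fin.sum_univ_eq_sum_range (fun j => if a = j then F j else 0) n, Finset.sum_ite_eq]
  simp

theorem plumbMat_mulVec_center (k m : ℕ) (F : ℕ → ℤ) (e : ℤ) :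
    (plumbMat k m *ᵥ legVec k m F e) none = -(2 ^ k) * F 0 + e + 2 ^ k * F 1 := by
  simp [Matrix.mulVec, dotProduct, Fintype.sum_option, Fintype.sum_prod_type, plumbMat, legVec,
    plumbWt, plumbAdj]
  ring

theorem plumbMat_mulVec_u (k m : ℕ) (F : ℕ → ℤ) (e : ℤ) :
    (plumbMat k m *ᵥ legVec k m F e) (some none) = F 0 - m * e := by
  simp [Matrix.mulVec, dotProduct, Fintype.sum_option, plumbMat, legVec, plumbWt,
    plumbAdj]
  ring

theorem plumbMat_leg_leg (k m : ℕ) (i i' : Fin (2 ^ k)) (j j' : Fin (2 ^ k * m + 7)) :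
    plumbMat k m (some (some (i, j))) (some (some (i', j'))) =
      if i = i' then
        (if j.val = j'.val then plumbWt k m (some (some (i, j))) else 0)
          + (if j.val + 1 = j'.val then 1 else 0) + (if j.val = j'.val + 1 then 1 else 0)
      else 0 := by
  simp only [plumbMat, Matrix.of_apply, plumbAdj, Option.some.injEq, Prod.mk.injEq, Fin.ext_iff,
    Bool.and_eq_true, Bool.or_eq_true, beq_iff_eq]
  split_ifs <;> omega

theorem plumbMat_mulVec_leg (k m : ℕ) (F : ℕ → ℤ) (e : ℤ) (hF : F (2 ^ k * m + 8) = 0)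
    (i : Fin (2 ^ k)) (j : Fin (2 ^ k * m + 7)) :
    (plumbMat k m *ᵥ legVec k m F e) (some (some (i, j))) =
      F j.val + plumbWt k m (some (some (i, j))) * F (j.val + 1) + F (j.val + 2) := by
  set c := plumbWt k m (some (some (i, j))) with hc
  have hself := Fin.sum_ite_val_eq (n := 2 ^ k * m + 7) (fun a => c * F (a + 1)) j.val
  have hnext := Fin.sum_ite_val_eq (n := 2 ^ k * m + 7) (fun a => F (a + 1)) (j.val + 1)
  have hlast : (if j.val + 1 < 2 ^ k * m + 7 then F (j.val + 2) else 0) = F (j.val + 2) := by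
    split_ifs with h
    · rfl
    · rw [← hF]
      congr 1
      omega
  have hprev : (if j.val = 0 then F 0 else 0)
      + ∑ j' : Fin (2 ^ k * m + 7), (if j.val = j'.val + 1 then F (j'.val + 1) else 0)
        = F j.val := by
    obtain ⟨a, ha⟩ := j
    cases a with
    | zero => simp
    | succ a =>
      have h := Fin.sum_ite_val_eq (n := 2 ^ k * m + 7) (fun a => F (a + 1)) a
      have ha' : a < 2 ^ k * m + 7 := by omega
      simpa [ha'] using h
  have hu : plumbMat k m (some (some (i, j))) (some none) = 0 := by simp [plumbMat, plumbAdj]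
  have hcen : plumbMat k m (some (some (i, j))) none = if j.val = 0 then 1 else 0 := by
    simp [plumbMat, plumbAdj]
  simp only [Matrix.mulVec, dotProduct, Fintype.sum_option, Fintype.sum_prod_type, hu, hcen,
    plumbMat_leg_leg, legVec, ← hc, ite_mul, add_mul, zero_mul, one_mul]
  rw [Finset.sum_comm]
  simp only [Finset.sum_ite_eq, Finset.mem_univ, if_true, Finset.sum_add_distrib]
  rw [hself, hnext, if_pos j.isLt, hlast, ← hprev]
  ring

theorem plumbMat_nonneg_of_ne (k m : ℕ) {x y : PlumbVtx k m} (h : x ≠ y) :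
    0 ≤ plumbMat k m x y := by
  rw [plumbMat, Matrix.of_apply, if_neg h]
  split_ifs <;> norm_num

/-- There is a positive integer vector which the plumbing matrix sends to a negative one. -/
theorem exists_pos_plumbMat_mulVec_neg (k m : ℕ) (hk : 1 ≤ k) (hm : 1 ≤ m) :
    ∃ d : PlumbVtx k m → ℤ, (∀ x, 0 < d x) ∧ ∀ x, (plumbMat k m *ᵥ d) x < 0 := by
  obtain ⟨M, hM⟩ : ∃ M, M = 2 ^ k * m := ⟨_, rfl⟩
  have hq : (2 : ℤ) ≤ 2 ^ k := by exact_mod_cast Nat.le_self_pow (by omega) 2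
  have hm' : (1 : ℤ) ≤ m := by exact_mod_cast hm
  have hMz : (M : ℤ) = 2 ^ k * m := by rw [hM]; push_cast; rfl
  have hM2 : (2 : ℤ) ≤ M := by rw [hMz]; nlinarith
  have hML : 0 < 4 * (M : ℤ) * (M + 7) := by positivity
  let f : ℕ → ℤ := fun j => if j + 1 ≤ M then 10 * (M - j) - 1 else M + 8 - j
  let F : ℕ → ℤ := fun j => 4 * M * (M + 7) * f j + j * (M + 8 - j)
  let e : ℤ := 40 * M * (M + 7) * 2 ^ k - 2 * 2 ^ k * (M + 7)
  have hF8 : F (2 ^ k * m + 8) = 0 := by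
    simp [F, f, ← hM]
  have hFpos : ∀ j, j < M + 8 → 0 < F j := by
    intro j hj
    have hf : 0 < f j := by
      simp only [f]
      split_ifs <;> omega
    have hj' : (0 : ℤ) ≤ M + 8 - j := by omega
    have := mul_pos hML hf
    have := mul_nonneg (Int.natCast_nonneg j) hj'
    simp only [F]
    linarith
  refine ⟨legVec k m F e, ?_, ?_⟩
  · rintro (_ | _ | ⟨i, j⟩)
    · exact hFpos 0 (by omega)
    · have : 0 < (2 ^ k : ℤ) * (M + 7) * (40 * M - 2) := by
        apply mul_pos (by positivity)
        omega
      simp only [legVec, e]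
      linarith
    · exact hFpos (j.val + 1) (by have := j.isLt; omega)
  · have hf0 : f 0 = 10 * M - 1 := by
      simp only [f]
      split_ifs <;> omega
    have hf1 : f 1 = 10 * M - 11 := by
      simp only [f]
      split_ifs <;> omega
    rintro (_ | _ | ⟨i, j⟩)
    · rw [plumbMat_mulVec_center]
      simp only [F, e, hf0, hf1]
      have : (0 : ℤ) < 2 ^ k * (M + 7) := by positivity
      push_cast
      linarith
    · rw [plumbMat_mulVec_u]
      simp only [F, e, hf0]
      have h : (m : ℤ) * (40 * M * (M + 7) * 2 ^ k - 2 * 2 ^ k * (M + 7))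
          = M * (40 * M * (M + 7) - 2 * (M + 7)) := by
        rw [hMz]
        ring
      rw [h]
      push_cast
      nlinarith
    · rw [plumbMat_mulVec_leg k m F e hF8]
      obtain ⟨a, ha⟩ := j
      rw [← hM] at ha
      simp only [plumbWt, ← hM]
      have key : f a + (if a + 2 = M then -3 else -2) * f (a + 1) + f (a + 2) = 0 := by
        simp only [f]
        split_ifs <;> push_cast <;> omega
      have hpos : (0 : ℤ) ≤ (a + 1) * (M + 7 - a) := by
        apply mul_nonneg <;> omega
      have hF : F a + (if a + 2 = M then -3 else -2) * F (a + 1) + F (a + 2)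
          = 4 * M * (M + 7)
              * (f a + (if a + 2 = M then -3 else -2) * f (a + 1) + f (a + 2))
            - 2 - (if a + 2 = M then 1 else 0) * ((a + 1) * (M + 7 - a)) := by
        simp only [F]
        split_ifs <;> push_cast <;> ring
      rw [hF, key]
      split_ifs <;> linarith

theorem matSig_plumbMat (k m : ℕ) (hk : 1 ≤ k) (hm : 1 ≤ m)
    (hA : ((plumbMat k m).map (fun a : ℤ => (a : ℝ))).IsHermitian) :
    matSig _ hA = -(2 + 2 ^ k * (2 ^ k * m + 7)) := by
  obtain ⟨d, hd, hAd⟩ := exists_pos_plumbMat_mulVec_neg k m hk hm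
  rw [matSig_eq_neg_card hA (eigenvalues_neg_of_mulVec_neg hA
    (fun x y h => Int.cast_nonneg (plumbMat_nonneg_of_ne k m h)) (fun x => (d x : ℝ))
    (fun x => by exact_mod_cast hd x) fun x => ?_)]
  · simp
    ring
  · have h : (((plumbMat k m *ᵥ d) x : ℤ) : ℝ) < 0 := by exact_mod_cast hAd x
    simpa [Matrix.mulVec, dotProduct] using h

theorem sum_range_ite_even_le (n q : ℕ) :
    ∑ j ∈ Finset.range n, (if (j + 1) % 2 = 0 ∧ j + 1 ≤ 2 * q then (1 : ℤ) else 0)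
      = min (n / 2 : ℕ) q := by
  induction n with
  | zero => simp
  | succ n ih =>
    rw [Finset.sum_range_succ, ih]
    split_ifs <;> omega

theorem plumbW_dotProduct_mulVec (k m : ℕ) (hk : 1 ≤ k) (hm : 1 ≤ m) :
    plumbW k m ⬝ᵥ plumbMat k m *ᵥ plumbW k m = 2 ^ k - 2 ^ k * (2 ^ k * m) := by
  obtain ⟨q, hq⟩ : ∃ q, 2 ^ k * m = 2 * q + 2 := by
    obtain ⟨l, rfl⟩ : ∃ l, k = l + 1 := ⟨k - 1, by omega⟩
    have : 0 < 2 ^ l * m := by positivity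
    exact ⟨2 ^ l * m - 1, by rw [pow_succ, mul_right_comm]; omega⟩
  let F : ℕ → ℤ := fun j => if j % 2 = 0 ∧ j ≤ 2 * q then 1 else 0
  have hw : plumbW k m = legVec k m F 0 := by
    funext x
    rcases x with _ | _ | ⟨i, j⟩
    · simp [plumbW, legVec, F]
    · rfl
    · simp only [plumbW, legVec, F]
      congr 1
      apply propext
      omega
  have hF8 : F (2 ^ k * m + 8) = 0 := if_neg (by omega)
  have hleg (i : Fin (2 ^ k)) (j : Fin (2 ^ k * m + 7)) :
      F (j.val + 1) * (F j.val + plumbWt k m (some (some (i, j))) * F (j.val + 1)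
        + F (j.val + 2)) = -2 * F (j.val + 1) := by
    simp only [F, plumbWt]
    split_ifs <;> omega
  have hsum : ∑ j : Fin (2 ^ k * m + 7), F (j.val + 1) = q := by
    rw [Fin.sum_univ_eq_sum_range (fun j => F (j + 1)) (2 ^ k * m + 7), sum_range_ite_even_le]
    omega
  have hqz : (2 ^ k * m : ℤ) = 2 * q + 2 := by exact_mod_cast hq
  have hF0 : F 0 = 1 := if_pos (by omega)
  have hF1 : F 1 = 0 := if_neg (by omega)
  rw [hw, dotProduct]
  simp only [Fintype.sum_option, Fintype.sum_prod_type, plumbMat_mulVec_center,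
    plumbMat_mulVec_u, plumbMat_mulVec_leg k m F 0 hF8]
  simp only [legVec, hleg, ← Finset.mul_sum, hsum, hF0, hF1, hqz]
  simp
  ring

/-- For `k ≥ 1` and odd `m ≥ 1`, with `A = A(k,m)` the plumbing matrix and `w` the
spherical Wu class, one has `(σ(A) − wᵀAw)/8 = −2^k − 1/4` as rational numbers. -/
theorem stmt13 (k m : ℕ) (hk : 1 ≤ k) (hm : 1 ≤ m) (hmodd : Odd m)
    (hA : ((plumbMat k m).map (fun a : ℤ => (a : ℝ))).IsHermitian) :
    ((matSig ((plumbMat k m).map (fun a : ℤ => (a : ℝ))) hA : ℚ) -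
        ((plumbW k m ⬝ᵥ (plumbMat k m).mulVec (plumbW k m) : ℤ) : ℚ)) / 8
      = -((2 : ℚ) ^ k) - 1 / 4 := by
  rw [matSig_plumbMat k m hk hm hA, plumbW_dotProduct_mulVec k m hk hm]
  push_cast
  ring
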